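/- Let B be a k×n complex matrix with rows Z_1,...,Z_k (k ≤ n), all rows nonzero and B of full rank k. Let H_j be the span of all rows except the j-th, and s_1(B) ≥ ... ≥ s_k(B) the singular values. Then ∑_{j=1}^k s_j(B)^{-2} = ∑_{j=1}^k dist(Z_j, H_j)^{-2}. -/

import Mathlib

open Finset Matrix

theorem dist_aux {E : Type*} [NormedAddCommGroup E] [InnerProductSpace ℂ E] (K : Submodule ℂ E)
    (z u : E) (h : z - u ∈ K) (hu : ∀ v ∈ K, inner ℂ u v = 0) :
    Metric.infDist z (K : Set E) = ‖u‖ := by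
  apply le_antisymm
  · have := Metric.infDist_le_dist_of_mem (x := z) (s := (K : Set E)) h
    simpa [dist_eq_norm] using this
  · refine (Metric.le_infDist ⟨0, K.zero_mem⟩).2 fun y hy => ?_
    rw [dist_eq_norm]
    have e : z - y = u + ((z - u) - y) := by abel
    have h2 := norm_add_sq_eq_norm_sq_add_norm_sq_of_inner_eq_zero u ((z-u)-y)
      (hu _ (K.sub_mem h hy))
    rw [← e] at h2
    nlinarith [norm_nonneg u, norm_nonneg (z-y), mul_self_nonneg ‖z-u-y‖]

theorem row_aux {E : Type*} [NormedAddCommGroup E] [InnerProductSpace ℂ E] {k : ℕ}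
    (Z : Fin k → E) (g : Fin k → ℂ) (j : Fin k)
    (h : ∀ l, inner ℂ (∑ i, g i • Z i) (Z l) = if l = j then 1 else 0) :
    g j = (((Metric.infDist (Z j) (Submodule.span ℂ
      ((fun i : {i : Fin k // i ≠ j} => Z i.1) '' Set.univ) : Set E)) ^ 2)⁻¹ : ℝ) := by
  obtain ⟨w, hw⟩ : ∃ w, w = ∑ i, g i • Z i := ⟨_, rfl⟩
  rw [← hw] at h
  have h1 : inner ℂ w w = g j := by
    conv_lhs => rw [hw, ← hw]
    conv_lhs => arg 3; rw [hw]
    simp [inner_sum, inner_smul_right, h]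
  rw [inner_self_eq_norm_sq_to_K] at h1
  have hw0 : w ≠ 0 := by
    rintro rfl
    have := h j
    simp at this
  have hn : ‖w‖ ≠ 0 := norm_ne_zero_iff.2 hw0
  have hg : g j ≠ 0 := by rw [← h1]; simpa using hw0
  rw [dist_aux _ (Z j) ((g j)⁻¹ • w)]
  · rw [norm_smul, ← h1]
    simp
    field_simp
  · have : Z j - (g j)⁻¹ • w = -((g j)⁻¹ • ∑ i ∈ univ.erase j, g i • Z i) := by
      rw [hw, ← Finset.add_sum_erase _ _ (mem_univ j), smul_add, smul_smul, inv_mul_cancel₀ hg]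
      simp
    rw [this]
    refine Submodule.neg_mem _ (Submodule.smul_mem _ _ (Submodule.sum_mem _ fun i hi => ?_))
    exact Submodule.smul_mem _ _ (Submodule.subset_span
      ⟨⟨i, (Finset.mem_erase.1 hi).1⟩, trivial, rfl⟩)
  · intro v hv
    induction hv using Submodule.span_induction with
    | mem x hx =>
      obtain ⟨i, -, rfl⟩ := hx
      simp [inner_smul_left, h, i.2]
    | zero => simp
    | add x y _ _ hx hy => rw [inner_add_right, hx, hy, add_zero]
    | smul a x _ hx => rw [inner_smul_right, hx, mul_zero]

open scoped ComplexOrder in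
theorem rank_aux {k n : ℕ} (B : Matrix (Fin k) (Fin n) ℂ) : (B * Bᴴ).rank = B.rank :=
  rank_self_mul_conjTranspose B

theorem trace_inv_aux {k : ℕ} (A : Matrix (Fin k) (Fin k) ℂ) (hA : A.IsHermitian)
    (h0 : ∀ i, hA.eigenvalues i ≠ 0) :
    A⁻¹.trace = ((∑ i, (hA.eigenvalues i)⁻¹ : ℝ) : ℂ) := by
  have hs := hA.spectral_theorem
  rw [Unitary.conjStarAlgAut_apply] at hs
  set U : Matrix (Fin k) (Fin k) ℂ := hA.eigenvectorUnitary.1 with hU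
  have h1 : star U * U = 1 := Unitary.coe_star_mul_self _
  have h2 : U * star U = 1 := Unitary.coe_mul_star_self _
  set D : Matrix (Fin k) (Fin k) ℂ := diagonal (RCLike.ofReal ∘ hA.eigenvalues) with hD
  set D' : Matrix (Fin k) (Fin k) ℂ := diagonal (fun i => ((hA.eigenvalues i)⁻¹ : ℂ)) with hD'
  have h3 : D * D' = 1 := by
    rw [hD, hD', diagonal_mul_diagonal, ← diagonal_one]
    congr 1
    ext i
    simp [h0 i]
  have h4 : A⁻¹ = U * D' * star U := by
    apply Matrix.inv_eq_right_inv
    calc A * (U * D' * star U) = (U * D * star U) * (U * D' * star U) := by rw [← hs]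
      _ = U * D * (star U * U) * D' * star U := by simp only [Matrix.mul_assoc]
      _ = U * (D * D') * star U := by rw [h1]; simp only [Matrix.mul_assoc, Matrix.one_mul]
      _ = 1 := by rw [h3, Matrix.mul_one, h2]
  rw [h4, Matrix.trace_mul_comm, ← Matrix.mul_assoc, h1, Matrix.one_mul, hD', trace_diagonal]
  push_cast
  rfl


/-- Negative second moment identity: for a full-rank `k×n` matrix `B` with nonzero rows
`Z_1,...,Z_k`, `∑_j s_j(B)⁻² = ∑_j dist(Z_j, H_j)⁻²` where `H_j` is the span of the other
rows and the `s_j(B)²` are the eigenvalues of `B Bᴴ`. -/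
theorem negative_second_moment_identity (k n : ℕ) (hk : k ≤ n)
    (B : Matrix (Fin k) (Fin n) ℂ)
    (hrank : B.rank = k) (hrows : ∀ j, B j ≠ 0)
    (hH : (B * Bᴴ).IsHermitian) :
    ∑ j : Fin k, (hH.eigenvalues j)⁻¹ =
      ∑ j : Fin k,
        ((Metric.infDist ((WithLp.equiv 2 (Fin n → ℂ)).symm (B j))
            (Submodule.span ℂ
              ((fun i : {i : Fin k // i ≠ j} => (WithLp.equiv 2 (Fin n → ℂ)).symm (B i.1)) ''
                Set.univ) : Set (EuclideanSpace ℂ (Fin n)))) ^ 2)⁻¹ := by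
  have h0 : ∀ i, hH.eigenvalues i ≠ 0 := by
    have h1 := hH.rank_eq_card_non_zero_eigs
    rw [rank_aux, hrank] at h1
    by_contra! hc
    obtain ⟨i, hi⟩ := hc
    have := Fintype.card_subtype_lt (p := fun i => hH.eigenvalues i ≠ 0) (x := i) (by simpa using hi)
    rw [← h1, Fintype.card_fin] at this
    exact lt_irrefl _ this
  have hdet : IsUnit (B * Bᴴ).det := by
    rw [hH.det_eq_prod_eigenvalues, isUnit_iff_ne_zero]
    exact Finset.prod_ne_zero_iff.2 fun i _ => by simpa using h0 i
  have ht := trace_inv_aux _ hH h0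
  apply Complex.ofReal_injective
  rw [← ht, Matrix.trace, Complex.ofReal_sum]
  refine Finset.sum_congr rfl fun j _ => ?_
  refine row_aux (fun i => (WithLp.equiv 2 (Fin n → ℂ)).symm (B i)) (fun i => (B * Bᴴ)⁻¹ j i) j ?_
  intro l
  have key : ((B * Bᴴ) * ((B * Bᴴ)⁻¹)ᴴ) l j = if l = j then 1 else 0 := by
    rw [conjTranspose_nonsing_inv, hH.eq, Matrix.mul_nonsing_inv _ hdet, Matrix.one_apply]
  rw [← key, Matrix.mul_apply, sum_inner]
  refine Finset.sum_congr rfl fun i _ => ?_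
  rw [inner_smul_left, EuclideanSpace.inner_eq_star_dotProduct, conjTranspose_apply, mul_comm]
  rfl
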